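/- Let L₁ and L₂ be finite-dimensional Lie algebras over k and let L = L₁ × L₂ be their direct product. Then: (1) i(L) = i(L₁) + i(L₂) and Z(L) = Z(L₁) × Z(L₂); (2) L is square integrable if and only if both L₁ and L₂ are square integrable; (3) L has a CP (resp. a CP-ideal) if and only if both L₁ and L₂ have a CP (resp. a CP-ideal). -/

import Mathlib

open Module

noncomputable section

variable (k : Type*) [Field k]

/-- `L(f) = {x ∈ L | f ⁅x, y⁆ = 0 for all y ∈ L}`. -/
def lieStab (L : Type*) [LieRing L] [LieAlgebra k L] (f : Module.Dual k L) :
    Submodule k L where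
  carrier := {x | ∀ y : L, f ⁅x, y⁆ = 0}
  add_mem' := fun {a b} ha hb y => by rw [add_lie, map_add, ha y, hb y, add_zero]
  zero_mem' := fun y => by rw [zero_lie, map_zero]
  smul_mem' := fun c a ha y => by rw [smul_lie, map_smul, ha y, smul_zero]

/-- The index `i(L)`, the minimum of `dim L(f)` over all `f ∈ L*`. -/
def lieIndex (L : Type*) [LieRing L] [LieAlgebra k L] : ℕ :=
  ⨅ f : Module.Dual k L, finrank k (lieStab k L f)

/-- `f ∈ L*` is regular if `dim L(f) = i(L)`. -/
def LieIsRegular (L : Type*) [LieRing L] [LieAlgebra k L] (f : Module.Dual k L) : Prop :=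
  finrank k (lieStab k L f) = lieIndex k L

/-- A commutative polarization of `L`: an abelian Lie subalgebra `P` with
`2 dim P = dim L + i(L)`. -/
def IsCP (L : Type*) [LieRing L] [LieAlgebra k L] (P : LieSubalgebra k L) : Prop :=
  IsLieAbelian ↥P ∧ 2 * finrank k ↥P = finrank k L + lieIndex k L

/-- A CP-ideal of `L`: a CP which is also a Lie ideal of `L`. -/
def IsCPIdeal (L : Type*) [LieRing L] [LieAlgebra k L] (P : LieSubalgebra k L) : Prop :=
  IsCP k L P ∧ ∀ x y : L, y ∈ P → ⁅x, y⁆ ∈ P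

/-- `L` is square integrable if `i(L) = dim Z(L)`. -/
def SquareIntegrable (L : Type*) [LieRing L] [LieAlgebra k L] : Prop :=
  lieIndex k L = finrank k ↥(LieAlgebra.center k L)


/-- The direct product of two Lie rings. -/
instance prodLieRing (L₁ L₂ : Type*) [LieRing L₁] [LieRing L₂] : LieRing (L₁ × L₂) :=
  { (inferInstance : AddCommGroup (L₁ × L₂)) with
    bracket := fun x y => (⁅x.1, y.1⁆, ⁅x.2, y.2⁆)
    add_lie := fun x y z => by
      show (⁅x.1 + y.1, z.1⁆, ⁅x.2 + y.2, z.2⁆) = _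
      simp [add_lie, Prod.ext_iff]
    lie_add := fun x y z => by
      show (⁅x.1, y.1 + z.1⁆, ⁅x.2, y.2 + z.2⁆) = _
      simp [lie_add, Prod.ext_iff]
    lie_self := fun x => by
      show (⁅x.1, x.1⁆, ⁅x.2, x.2⁆) = 0
      simp [Prod.ext_iff]
    leibniz_lie := fun x y z => by
      show (⁅x.1, ⁅y.1, z.1⁆⁆, ⁅x.2, ⁅y.2, z.2⁆⁆) = _
      simp [Prod.ext_iff] }

/-- The direct product of two Lie algebras. -/
instance prodLieAlgebra (K L₁ L₂ : Type*) [CommRing K] [LieRing L₁] [LieRing L₂]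
    [LieAlgebra K L₁] [LieAlgebra K L₂] : LieAlgebra K (L₁ × L₂) where
  lie_smul := fun t x y => by
    show (⁅x.1, (t • y).1⁆, ⁅x.2, (t • y).2⁆) = t • (⁅x.1, y.1⁆, ⁅x.2, y.2⁆)
    simp [lie_smul]

theorem lieIndex_le (L : Type*) [LieRing L] [LieAlgebra k L] (f : Module.Dual k L) :
    lieIndex k L ≤ finrank k (lieStab k L f) :=
  ciInf_le (OrderBot.bddBelow _) f

theorem exists_lieIsRegular (L : Type*) [LieRing L] [LieAlgebra k L] :
    ∃ f : Module.Dual k L, LieIsRegular k L f :=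
  Nat.sInf_mem (Set.range_nonempty fun f : Module.Dual k L => finrank k (lieStab k L f))

theorem finrank_submodule_prod {V W : Type*} [AddCommGroup V] [Module k V] [AddCommGroup W]
    [Module k W] [FiniteDimensional k V] [FiniteDimensional k W]
    (p : Submodule k V) (q : Submodule k W) :
    finrank k (p.prod q) = finrank k p + finrank k q := by
  let e : p.prod q ≃ₗ[k] p × q := { AddSubmonoid.prodEquiv p.toAddSubmonoid q.toAddSubmonoid with
    map_smul' := fun _ _ => rfl }
  rw [e.finrank_eq, finrank_prod]

theorem prod_lie_def {L₁ L₂ : Type*} [LieRing L₁] [LieRing L₂] (x y : L₁ × L₂) :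
    ⁅x, y⁆ = (⁅x.1, y.1⁆, ⁅x.2, y.2⁆) := rfl

theorem lieStab_coprod {L₁ L₂ : Type*} [LieRing L₁] [LieAlgebra k L₁] [LieRing L₂]
    [LieAlgebra k L₂] (f₁ : Module.Dual k L₁) (f₂ : Module.Dual k L₂) :
    lieStab k (L₁ × L₂) (f₁.coprod f₂) = (lieStab k L₁ f₁).prod (lieStab k L₂ f₂) := by
  ext x
  refine ⟨fun h => ⟨fun y => ?_, fun y => ?_⟩, fun h y => ?_⟩
  · simpa [prod_lie_def] using h (y, 0)
  · simpa [prod_lie_def] using h (0, y)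
  · rw [prod_lie_def, LinearMap.coprod_apply, h.1 y.1, h.2 y.2, add_zero]

theorem lieIndex_prod (L₁ L₂ : Type*) [LieRing L₁] [LieAlgebra k L₁] [LieRing L₂]
    [LieAlgebra k L₂] [FiniteDimensional k L₁] [FiniteDimensional k L₂] :
    lieIndex k (L₁ × L₂) = lieIndex k L₁ + lieIndex k L₂ := by
  apply le_antisymm
  · obtain ⟨f₁, h₁⟩ := exists_lieIsRegular k L₁
    obtain ⟨f₂, h₂⟩ := exists_lieIsRegular k L₂
    rw [← h₁, ← h₂, ← finrank_submodule_prod, ← lieStab_coprod]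
    exact lieIndex_le k _ _
  · obtain ⟨f, h⟩ := exists_lieIsRegular k (L₁ × L₂)
    have hf : f = (f ∘ₗ LinearMap.inl k L₁ L₂).coprod (f ∘ₗ LinearMap.inr k L₁ L₂) := by
      rw [← LinearMap.comp_coprod, LinearMap.coprod_inl_inr, LinearMap.comp_id]
    rw [← h, hf, lieStab_coprod, finrank_submodule_prod]
    exact add_le_add (lieIndex_le k _ _) (lieIndex_le k _ _)

theorem center_prod_toSubmodule (L₁ L₂ : Type*) [LieRing L₁] [LieAlgebra k L₁] [LieRing L₂]
    [LieAlgebra k L₂] :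
    (LieAlgebra.center k (L₁ × L₂)).toSubmodule =
      (LieAlgebra.center k L₁).toSubmodule.prod (LieAlgebra.center k L₂).toSubmodule := by
  ext x
  simp only [LieSubmodule.mem_toSubmodule, Submodule.mem_prod, LieModule.mem_maxTrivSubmodule]
  refine ⟨fun h => ⟨fun y => ?_, fun y => ?_⟩, fun h y => ?_⟩
  · exact congrArg Prod.fst (h (y, 0))
  · exact congrArg Prod.snd (h (0, y))
  · exact Prod.ext (h.1 y.1) (h.2 y.2)

theorem finrank_center_prod (L₁ L₂ : Type*) [LieRing L₁] [LieAlgebra k L₁] [LieRing L₂]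
    [LieAlgebra k L₂] [FiniteDimensional k L₁] [FiniteDimensional k L₂] :
    finrank k (LieAlgebra.center k (L₁ × L₂)) =
      finrank k (LieAlgebra.center k L₁) + finrank k (LieAlgebra.center k L₂) := by
  change finrank k (LieAlgebra.center k (L₁ × L₂)).toSubmodule = _
  rw [center_prod_toSubmodule, finrank_submodule_prod]
  rfl

theorem finrank_center_le_lieIndex (L : Type*) [LieRing L] [LieAlgebra k L]
    [FiniteDimensional k L] : finrank k (LieAlgebra.center k L) ≤ lieIndex k L := by
  obtain ⟨f, h⟩ := exists_lieIsRegular k L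
  rw [← h]
  refine Submodule.finrank_mono (s := (LieAlgebra.center k L).toSubmodule) fun x hx y => ?_
  rw [LieSubmodule.mem_toSubmodule, LieModule.mem_maxTrivSubmodule] at hx
  rw [← lie_skew, hx y, neg_zero, map_zero]

theorem isLieAbelian_lieSubalgebra_iff {L : Type*} [LieRing L] [LieAlgebra k L]
    (P : LieSubalgebra k L) : IsLieAbelian P ↔ ∀ x ∈ P, ∀ y ∈ P, ⁅x, y⁆ = 0 :=
  ⟨fun h x hx y hy => congrArg Subtype.val (h.trivial ⟨x, hx⟩ ⟨y, hy⟩),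
    fun h => ⟨fun x y => Subtype.ext (h x x.2 y y.2)⟩⟩

/-- The linear map `x ↦ f ⁅x, ·⁆` from `L` to its dual. -/
def lieDualMap {L : Type*} [LieRing L] [LieAlgebra k L] (f : Module.Dual k L) :
    L →ₗ[k] Module.Dual k L :=
  (LinearMap.llcomp k L L k f) ∘ₗ (LieAlgebra.ad k L : L →ₗ[k] Module.End k L)

theorem lieDualMap_apply {L : Type*} [LieRing L] [LieAlgebra k L] (f : Module.Dual k L)
    (x y : L) : lieDualMap k f x y = f ⁅x, y⁆ := rfl

/-- An abelian subalgebra is isotropic for every form `f ⁅x, y⁆`, which bounds its dimension. -/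
theorem two_mul_finrank_le_of_isLieAbelian {L : Type*} [LieRing L] [LieAlgebra k L]
    [FiniteDimensional k L] (P : LieSubalgebra k L) (hP : IsLieAbelian P) :
    2 * finrank k P ≤ finrank k L + lieIndex k L := by
  rw [isLieAbelian_lieSubalgebra_iff] at hP
  obtain ⟨f, h⟩ := exists_lieIsRegular k L
  rw [← h]
  let φ := (lieDualMap k f).domRestrict P.toSubmodule
  have hrange : finrank k φ.range ≤ finrank k P.toSubmodule.dualAnnihilator := by
    apply Submodule.finrank_mono
    rintro _ ⟨x, rfl⟩
    rw [Submodule.mem_dualAnnihilator]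
    intro y hy
    change f ⁅(x : L), y⁆ = 0
    rw [hP x x.2 y hy, map_zero]
  have hker : finrank k φ.ker ≤ finrank k (lieStab k L f) := by
    rw [(Submodule.equivMapOfInjective _ P.toSubmodule.injective_subtype φ.ker).finrank_eq]
    apply Submodule.finrank_mono
    rintro _ ⟨x, hx, rfl⟩ y
    exact LinearMap.congr_fun hx y
  have hφ := φ.finrank_range_add_finrank_ker
  have hann := Subspace.finrank_add_finrank_dualAnnihilator_eq P.toSubmodule
  change _ = finrank k P at hφ
  change finrank k P + _ = _ at hann
  omega

/-- The product of two Lie subalgebras, as a Lie subalgebra of the direct product. -/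
def lieSubalgebraProd {L₁ L₂ : Type*} [LieRing L₁] [LieAlgebra k L₁] [LieRing L₂]
    [LieAlgebra k L₂] (P₁ : LieSubalgebra k L₁) (P₂ : LieSubalgebra k L₂) :
    LieSubalgebra k (L₁ × L₂) :=
  { P₁.toSubmodule.prod P₂.toSubmodule with
    lie_mem' := fun hx hy => ⟨P₁.lie_mem hx.1 hy.1, P₂.lie_mem hx.2 hy.2⟩ }

/-- The first projection of a direct product of Lie algebras. -/
def lieFst (L₁ L₂ : Type*) [LieRing L₁] [LieAlgebra k L₁] [LieRing L₂] [LieAlgebra k L₂] :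
    (L₁ × L₂) →ₗ⁅k⁆ L₁ :=
  { LinearMap.fst k L₁ L₂ with map_lie' := rfl }

/-- The second projection of a direct product of Lie algebras. -/
def lieSnd (L₁ L₂ : Type*) [LieRing L₁] [LieAlgebra k L₁] [LieRing L₂] [LieAlgebra k L₂] :
    (L₁ × L₂) →ₗ⁅k⁆ L₂ :=
  { LinearMap.snd k L₁ L₂ with map_lie' := rfl }

theorem isLieAbelian_map {L M : Type*} [LieRing L] [LieAlgebra k L] [LieRing M]
    [LieAlgebra k M] (g : L →ₗ⁅k⁆ M) {P : LieSubalgebra k L} (hP : IsLieAbelian P) :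
    IsLieAbelian (P.map g) := by
  rw [isLieAbelian_lieSubalgebra_iff] at hP ⊢
  rintro _ ⟨x, hx, rfl⟩ _ ⟨y, hy, rfl⟩
  change ⁅g x, g y⁆ = 0
  rw [← LieHom.map_lie, hP x hx y hy, map_zero]

theorem lie_mem_map_of_surjective {L M : Type*} [LieRing L] [LieAlgebra k L] [LieRing M]
    [LieAlgebra k M] (g : L →ₗ⁅k⁆ M) (hg : Function.Surjective g) {P : LieSubalgebra k L}
    (hP : ∀ x y : L, y ∈ P → ⁅x, y⁆ ∈ P) (x y : M) (hy : y ∈ P.map g) : ⁅x, y⁆ ∈ P.map g := by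
  obtain ⟨x, rfl⟩ := hg x
  obtain ⟨y, hy, rfl⟩ := hy
  exact ⟨⁅x, y⁆, hP x y hy, g.map_lie x y⟩

section Prod

variable {L₁ L₂ : Type*} [LieRing L₁] [LieAlgebra k L₁] [LieRing L₂] [LieAlgebra k L₂]
  [FiniteDimensional k L₁] [FiniteDimensional k L₂]

theorem finrank_lieSubalgebraProd (P₁ : LieSubalgebra k L₁) (P₂ : LieSubalgebra k L₂) :
    finrank k (lieSubalgebraProd k P₁ P₂) = finrank k P₁ + finrank k P₂ :=
  finrank_submodule_prod k P₁.toSubmodule P₂.toSubmodule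

theorem IsCP.lieSubalgebraProd {P₁ : LieSubalgebra k L₁} {P₂ : LieSubalgebra k L₂}
    (h₁ : IsCP k L₁ P₁) (h₂ : IsCP k L₂ P₂) :
    IsCP k (L₁ × L₂) (lieSubalgebraProd k P₁ P₂) := by
  obtain ⟨a₁, d₁⟩ := h₁
  obtain ⟨a₂, d₂⟩ := h₂
  refine ⟨?_, ?_⟩
  · rw [isLieAbelian_lieSubalgebra_iff] at a₁ a₂ ⊢
    exact fun x hx y hy =>
      Prod.ext (a₁ x.1 hx.1 y.1 hy.1) (a₂ x.2 hx.2 y.2 hy.2)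
  · rw [finrank_lieSubalgebraProd, lieIndex_prod, finrank_prod]
    omega

theorem IsCP.map_fst_snd {P : LieSubalgebra k (L₁ × L₂)} (h : IsCP k (L₁ × L₂) P) :
    IsCP k L₁ (P.map (lieFst k L₁ L₂)) ∧ IsCP k L₂ (P.map (lieSnd k L₁ L₂)) := by
  obtain ⟨a, d⟩ := h
  have a₁ := isLieAbelian_map k (lieFst k L₁ L₂) a
  have a₂ := isLieAbelian_map k (lieSnd k L₁ L₂) a
  have d₁ := two_mul_finrank_le_of_isLieAbelian k _ a₁
  have d₂ := two_mul_finrank_le_of_isLieAbelian k _ a₂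
  have hle : finrank k P ≤ finrank k
      (_root_.lieSubalgebraProd k (P.map (lieFst k L₁ L₂)) (P.map (lieSnd k L₁ L₂))) :=
    Submodule.finrank_mono (s := P.toSubmodule) (t := (_root_.lieSubalgebraProd k
      (P.map (lieFst k L₁ L₂)) (P.map (lieSnd k L₁ L₂))).toSubmodule)
      fun x hx => ⟨⟨x, hx, rfl⟩, ⟨x, hx, rfl⟩⟩
  rw [finrank_lieSubalgebraProd] at hle
  rw [lieIndex_prod, finrank_prod] at d
  exact ⟨⟨a₁, by omega⟩, ⟨a₂, by omega⟩⟩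

end Prod

/-- **Lemma 2.1.**  For the direct product `L = L₁ × L₂`:
(1) `i(L) = i(L₁) + i(L₂)` and `Z(L) = Z(L₁) × Z(L₂)`;
(2) `L` is square integrable iff both `L₁` and `L₂` are;
(3) `L` has a CP (resp. a CP-ideal) iff both `L₁` and `L₂` have a CP (resp. a CP-ideal). -/
theorem direct_product_cp {k L₁ L₂ : Type*} [Field k] [CharZero k]
    [LieRing L₁] [LieAlgebra k L₁] [LieRing L₂] [LieAlgebra k L₂]
    [FiniteDimensional k L₁] [FiniteDimensional k L₂] :
    (lieIndex k (L₁ × L₂) = lieIndex k L₁ + lieIndex k L₂ ∧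
      (LieAlgebra.center k (L₁ × L₂)).toSubmodule =
        ((LieAlgebra.center k L₁).toSubmodule).prod ((LieAlgebra.center k L₂).toSubmodule)) ∧
    (SquareIntegrable k (L₁ × L₂) ↔ SquareIntegrable k L₁ ∧ SquareIntegrable k L₂) ∧
    ((∃ P : LieSubalgebra k (L₁ × L₂), IsCP k (L₁ × L₂) P) ↔
      (∃ P₁ : LieSubalgebra k L₁, IsCP k L₁ P₁) ∧ (∃ P₂ : LieSubalgebra k L₂, IsCP k L₂ P₂)) ∧
    ((∃ P : LieSubalgebra k (L₁ × L₂), IsCPIdeal k (L₁ × L₂) P) ↔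
      (∃ P₁ : LieSubalgebra k L₁, IsCPIdeal k L₁ P₁) ∧
        (∃ P₂ : LieSubalgebra k L₂, IsCPIdeal k L₂ P₂)) := by
  refine ⟨⟨lieIndex_prod k L₁ L₂, center_prod_toSubmodule k L₁ L₂⟩, ?_, ⟨?_, ?_⟩, ⟨?_, ?_⟩⟩
  · have h₁ := finrank_center_le_lieIndex k L₁
    have h₂ := finrank_center_le_lieIndex k L₂
    unfold SquareIntegrable
    rw [lieIndex_prod, finrank_center_prod]
    omega
  · rintro ⟨P, h⟩
    exact ⟨⟨_, (h.map_fst_snd k).1⟩, ⟨_, (h.map_fst_snd k).2⟩⟩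
  · rintro ⟨⟨P₁, h₁⟩, P₂, h₂⟩
    exact ⟨_, h₁.lieSubalgebraProd k h₂⟩
  · rintro ⟨P, h, hP⟩
    exact ⟨⟨_, (h.map_fst_snd k).1,
        lie_mem_map_of_surjective k (lieFst k L₁ L₂) Prod.fst_surjective hP⟩,
      ⟨_, (h.map_fst_snd k).2,
        lie_mem_map_of_surjective k (lieSnd k L₁ L₂) Prod.snd_surjective hP⟩⟩
  · rintro ⟨⟨P₁, h₁, i₁⟩, P₂, h₂, i₂⟩
    exact ⟨_, h₁.lieSubalgebraProd k h₂,
      fun x y hy => ⟨i₁ x.1 y.1 hy.1, i₂ x.2 y.2 hy.2⟩⟩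

end
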